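/- For any real number $y > 1$ and non-negative integer $j$, as $x \to \infty$ (with $x$ real, $x > 0$) one has $\zeta^{(j)}(y, x) = \sum_{t=0}^{j}\binom{j}{t}\frac{(-1)^j t!}{(y-1)^{t+1}}\frac{\log^{j-t}(x)}{x^{y-1}} + (-1)^j\frac{\log^j(x)}{2x^{y}} + O_{j,y}\left(\frac{\log^j x}{x^{y+1}}\right)$, where $\zeta^{(j)}(y,x)$ is the $j$-th derivative of the Hurwitz zeta function with respect to its first argument. -/

import Mathlib

open Finset Filter Asymptotics

/-- The Hurwitz zeta function `ζ(z, x) = ∑_{k ≥ 0} (k + x)^{-z}` as a function of the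
complex variable `z`. -/
noncomputable def HzetaC (z : ℂ) (x : ℝ) : ℂ := ∑' k : ℕ, ((k : ℂ) + (x : ℂ)) ^ (-z)

theorem abs_trapezoid_error_le {F f f₁ f₂ : ℝ → ℝ} {a M : ℝ} (hM : 0 ≤ M)
    (hF : ∀ u, a ≤ u → HasDerivAt F (f u) u) (hf : ∀ u, a ≤ u → HasDerivAt f (f₁ u) u)
    (hf₁ : ∀ u, a ≤ u → HasDerivAt f₁ (f₂ u) u) (hb : ∀ u ∈ Set.Icc a (a + 1), |f₂ u| ≤ M) :
    |F (a + 1) - F a - (f a + f (a + 1)) / 2| ≤ M := by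
  have hp : ∀ u ∈ Set.Icc a (a + 1), |(f u - f a) / 2 - (u - a) / 2 * f₁ u| ≤ M := by
    intro u hu
    have h := (convex_Icc a (a + 1)).norm_image_sub_le_of_norm_hasDerivWithin_le
      (f := fun u => (f u - f a) / 2 - (u - a) / 2 * f₁ u)
      (f' := fun u => f₁ u / 2 - (1 / 2 * f₁ u + (u - a) / 2 * f₂ u)) (C := M)
      (fun v hv => ((((hf v hv.1).sub_const _).div_const _).sub
        ((((hasDerivAt_id v).sub_const a).div_const 2).mul (hf₁ v hv.1))).hasDerivWithinAt)
      (fun v hv => by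
        have h1 := hb v hv
        have : f₁ v / 2 - (1 / 2 * f₁ v + (v - a) / 2 * f₂ v) = -((v - a) / 2 * f₂ v) := by ring
        rw [this, norm_neg, Real.norm_eq_abs, abs_mul, abs_of_nonneg (by linarith [hv.1])]
        calc (v - a) / 2 * |f₂ v| ≤ 1 * M := by
              gcongr
              linarith [hv.2, hv.1]
          _ = M := one_mul M)
      (Set.left_mem_Icc.2 (by linarith)) hu
    simp only [sub_self, zero_div, zero_mul, sub_zero, Real.norm_eq_abs] at h
    rw [abs_of_nonneg (show 0 ≤ u - a by linarith [hu.1])] at h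
    exact h.trans (mul_le_of_le_one_right hM (by linarith [hu.2]))
  have h := (convex_Icc a (a + 1)).norm_image_sub_le_of_norm_hasDerivWithin_le
      (f := fun u => F u - F a - (u - a) / 2 * (f a + f u))
      (f' := fun u => f u - (1 / 2 * (f a + f u) + (u - a) / 2 * f₁ u)) (C := M)
      (fun v hv => (((hF v hv.1).sub_const _).sub
        ((((hasDerivAt_id v).sub_const a).div_const 2).mul
          ((hf v hv.1).const_add _))).hasDerivWithinAt)
      (fun v hv => by
        convert hp v hv using 1
        rw [Real.norm_eq_abs]
        congr 1
        ring)
      (Set.left_mem_Icc.2 (by linarith)) (Set.right_mem_Icc.2 (by linarith))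
  simp only [sub_self, zero_div, zero_mul, sub_zero, Real.norm_eq_abs, add_sub_cancel_left,
    abs_one, mul_one] at h
  convert h using 2
  ring

/-- The function `t ↦ (log t) ^ n * t ^ (-s)`. -/
noncomputable def logPowRpow (n : ℕ) (s t : ℝ) : ℝ := Real.log t ^ n * t ^ (-s)

/-- The derivative of `logPowRpow`. -/
noncomputable def logPowRpowDeriv (n : ℕ) (s t : ℝ) : ℝ :=
  n * logPowRpow (n - 1) (s + 1) t - s * logPowRpow n (s + 1) t

theorem hasDerivAt_logPowRpow (n : ℕ) (s : ℝ) {t : ℝ} (ht : 0 < t) :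
    HasDerivAt (logPowRpow n s) (logPowRpowDeriv n s t) t := by
  have h := ((Real.hasDerivAt_log ht.ne').pow n).mul
    (Real.hasDerivAt_rpow_const (p := -s) (Or.inl ht.ne'))
  refine h.congr_deriv ?_
  have e : t ^ (-(s + 1)) = t ^ (-s) * t⁻¹ := by
    rw [neg_add, Real.rpow_add ht, Real.rpow_neg_one]
  have e' : t ^ (-s - 1) = t ^ (-s) * t⁻¹ := by
    rw [Real.rpow_sub_one ht.ne', div_eq_mul_inv]
  simp only [logPowRpowDeriv, logPowRpow, e, e', Pi.pow_apply]
  ring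

theorem logPowRpow_nonneg (n : ℕ) (s : ℝ) {t : ℝ} (ht : 1 ≤ t) : 0 ≤ logPowRpow n s t :=
  mul_nonneg (pow_nonneg (Real.log_nonneg ht) n) (Real.rpow_nonneg (by linarith) _)

theorem logPowRpow_pred_le (n : ℕ) (s : ℝ) {t : ℝ} (ht : Real.exp 1 ≤ t) :
    logPowRpow (n - 1) s t ≤ logPowRpow n s t := by
  have h0 : 0 < t := (Real.exp_pos 1).trans_le ht
  have h1 : 1 ≤ Real.log t := (Real.le_log_iff_exp_le h0).2 ht
  exact mul_le_mul_of_nonneg_right (pow_le_pow_right₀ h1 (Nat.sub_le n 1)) (Real.rpow_nonneg h0.le _)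

theorem natCast_mul_logPowRpow_pred_le {n : ℕ} (s : ℝ) {t : ℝ} (ht : 1 ≤ t)
    (hn : n ≤ Real.log t) : n * logPowRpow (n - 1) s t ≤ logPowRpow n s t := by
  rcases n with _ | m
  · simpa using logPowRpow_nonneg 0 s ht
  · have e : logPowRpow (m + 1) s t = Real.log t * logPowRpow m s t := by
      simp only [logPowRpow]
      ring
    rw [e, Nat.add_sub_cancel]
    exact mul_le_mul_of_nonneg_right hn (logPowRpow_nonneg m s ht)

theorem abs_logPowRpowDeriv_le (n : ℕ) {s t : ℝ} (hs : 0 ≤ s) (ht : Real.exp 1 ≤ t) :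
    |logPowRpowDeriv n s t| ≤ (n + s) * logPowRpow n (s + 1) t := by
  have h1 : 1 ≤ t := (Real.one_le_exp zero_le_one).trans ht
  have ha := logPowRpow_nonneg (n - 1) (s + 1) h1
  have hb := logPowRpow_nonneg n (s + 1) h1
  have hc := mul_le_mul_of_nonneg_left (logPowRpow_pred_le n (s + 1) ht) (Nat.cast_nonneg (α := ℝ) n)
  have hd := mul_nonneg (Nat.cast_nonneg (α := ℝ) n) ha
  have he := mul_nonneg hs hb
  rw [logPowRpowDeriv, abs_le]
  constructor <;> linarith

theorem logPowRpow_antitone {n : ℕ} {s : ℝ} (hs : 1 ≤ s) {t u : ℝ} (ht : Real.exp 1 ≤ t)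
    (hn : Real.exp n ≤ t) (htu : t ≤ u) : logPowRpow n s u ≤ logPowRpow n s t := by
  have hpos : 0 < t := (Real.exp_pos 1).trans_le ht
  refine antitoneOn_of_hasDerivWithinAt_nonpos (convex_Ici t)
    (f := logPowRpow n s) (f' := logPowRpowDeriv n s) ?_ ?_ ?_ Set.self_mem_Ici htu htu
  · exact fun v hv =>
      (hasDerivAt_logPowRpow n s (hpos.trans_le hv)).continuousAt.continuousWithinAt
  · intro v hv
    rw [interior_Ici] at hv
    exact (hasDerivAt_logPowRpow n s (hpos.trans hv)).hasDerivWithinAt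
  · intro v hv
    rw [interior_Ici] at hv
    have hv0 : 0 < v := hpos.trans hv
    have hl : (n : ℝ) ≤ Real.log v := (Real.le_log_iff_exp_le hv0).2 (hn.trans hv.le)
    have h1v : 1 ≤ v := (Real.one_le_exp zero_le_one).trans (ht.trans hv.le)
    have hg := logPowRpow_nonneg n (s + 1) h1v
    have key := natCast_mul_logPowRpow_pred_le (s + 1) h1v hl
    rw [logPowRpowDeriv]
    nlinarith

/-- The decrement of `logPowRpow n s` over a unit step controls `logPowRpow n (s + 1)`. -/
theorem logPowRpow_le_mul_sub {n : ℕ} {s : ℝ} (hs : 2 ≤ s) {t : ℝ} (ht : Real.exp 1 ≤ t)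
    (hn : Real.exp n ≤ t) :
    logPowRpow n (s + 1) t ≤ 2 ^ (s + 1) * (logPowRpow n s t - logPowRpow n s (t + 1)) := by
  have hpos : 0 < t := (Real.exp_pos 1).trans_le ht
  have h1t : 1 ≤ t := (Real.one_le_exp zero_le_one).trans ht
  obtain ⟨v, hv, hv'⟩ := exists_hasDerivAt_eq_slope (logPowRpow n s) (logPowRpowDeriv n s)
    (show t < t + 1 by linarith)
    (fun v hv => (hasDerivAt_logPowRpow n s (hpos.trans_le hv.1)).continuousAt.continuousWithinAt)
    (fun v hv => hasDerivAt_logPowRpow n s (hpos.trans hv.1))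
  rw [add_sub_cancel_left, div_one] at hv'
  have hv0 : 0 < v := hpos.trans hv.1
  have hl : (n : ℝ) ≤ Real.log v := (Real.le_log_iff_exp_le hv0).2 (hn.trans hv.1.le)
  have h1v : 1 ≤ v := h1t.trans hv.1.le
  have hg := logPowRpow_nonneg n (s + 1) h1v
  have key := natCast_mul_logPowRpow_pred_le (s + 1) h1v hl
  have hstep : logPowRpow n (s + 1) v ≤ logPowRpow n s t - logPowRpow n s (t + 1) := by
    rw [logPowRpowDeriv] at hv'
    nlinarith
  have hcmp : logPowRpow n (s + 1) t ≤ 2 ^ (s + 1) * logPowRpow n (s + 1) v := by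
    have hlog : Real.log t ^ n ≤ Real.log v ^ n :=
      pow_le_pow_left₀ (Real.log_nonneg h1t) (Real.log_le_log hpos hv.1.le) n
    have hrp : t ^ (-(s + 1)) ≤ 2 ^ (s + 1) * v ^ (-(s + 1)) := by
      rw [Real.rpow_neg hpos.le, Real.rpow_neg hv0.le, ← div_eq_mul_inv,
        ← Real.div_rpow zero_le_two hv0.le, ← Real.inv_rpow hpos.le]
      refine Real.rpow_le_rpow (by positivity) ?_ (by linarith)
      rw [inv_eq_one_div, div_le_div_iff₀ hpos hv0]
      linarith [hv.2]
    simp only [logPowRpow]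
    calc Real.log t ^ n * t ^ (-(s + 1))
        ≤ Real.log v ^ n * (2 ^ (s + 1) * v ^ (-(s + 1))) := by
          have := Real.log_nonneg h1v
          gcongr
      _ = _ := by ring
  exact hcmp.trans (mul_le_mul_of_nonneg_left hstep (by positivity))

theorem tendsto_logPowRpow (n : ℕ) {s : ℝ} (hs : 0 < s) :
    Tendsto (logPowRpow n s) atTop (nhds 0) := by
  have h := (isLittleO_log_rpow_rpow_atTop (n : ℝ) hs).tendsto_div_nhds_zero
  refine h.congr' ?_
  filter_upwards [eventually_gt_atTop 0] with t ht
  rw [logPowRpow, Real.rpow_neg ht.le, Real.rpow_natCast, div_eq_mul_inv]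

theorem tendsto_natCast_add_atTop (x : ℝ) :
    Tendsto (fun k : ℕ => (k : ℝ) + x) atTop atTop :=
  tendsto_atTop_add_const_right _ _ tendsto_natCast_atTop_atTop

theorem summable_logPowRpow (n : ℕ) {s : ℝ} (hs : 1 < s) (x : ℝ) :
    Summable (fun k : ℕ => logPowRpow n s (k + x)) := by
  obtain ⟨r, hr, hrs⟩ := exists_between hs
  refine summable_of_isBigO_nat ((Real.summable_one_div_nat_add_rpow x r).2 hr) ?_
  have h := (tendsto_logPowRpow n (sub_pos.2 hrs)).comp (tendsto_natCast_add_atTop x)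
  have h' := (h.isBigO_one ℝ).mul (isBigO_refl (fun k : ℕ => 1 / |(k : ℝ) + x| ^ r) atTop)
  refine h'.congr' ?_ (by simp)
  filter_upwards [(tendsto_natCast_add_atTop x).eventually_gt_atTop 0] with k hk
  simp only [Function.comp, logPowRpow]
  rw [abs_of_pos hk, one_div, ← Real.rpow_neg hk.le, mul_assoc, ← Real.rpow_add hk]
  congr 2
  ring

/-- The `n`-th derivative with respect to `z` of the summand `(k + x) ^ (-z)`. -/
noncomputable def hurwitzTerm (n : ℕ) (x : ℝ) (k : ℕ) (z : ℂ) : ℂ :=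
  (-(Real.log (k + x) : ℂ)) ^ n * ((k : ℂ) + (x : ℂ)) ^ (-z)

theorem hasDerivAt_hurwitzTerm (n : ℕ) {x : ℝ} (hx : 1 ≤ x) (k : ℕ) (z : ℂ) :
    HasDerivAt (hurwitzTerm n x k) (hurwitzTerm (n + 1) x k z) z := by
  have hpos : 0 < (k : ℝ) + x := by positivity
  have h0 : ((k : ℂ) + (x : ℂ)) ≠ 0 := by exact_mod_cast hpos.ne'
  have h := ((hasDerivAt_neg z).const_cpow (c := (k : ℂ) + (x : ℂ)) (Or.inl h0)).const_mul
    ((-(Real.log (k + x) : ℂ)) ^ n)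
  refine h.congr_deriv ?_
  rw [hurwitzTerm, Complex.ofReal_log hpos.le]
  push_cast
  ring

theorem norm_hurwitzTerm (n : ℕ) {x : ℝ} (hx : 1 ≤ x) (k : ℕ) (z : ℂ) :
    ‖hurwitzTerm n x k z‖ = logPowRpow n z.re (k + x) := by
  have h1 : 1 ≤ (k : ℝ) + x := by linarith [Nat.cast_nonneg (α := ℝ) k]
  have hpos : 0 < (k : ℝ) + x := by linarith
  have e : ((k : ℂ) + (x : ℂ)) = (((k : ℝ) + x : ℝ) : ℂ) := by push_cast; rfl
  rw [hurwitzTerm, e, norm_mul, Complex.norm_cpow_eq_rpow_re_of_pos hpos, norm_pow, norm_neg,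
    Complex.norm_real, Real.norm_of_nonneg (Real.log_nonneg h1), logPowRpow, Complex.neg_re]

theorem iteratedDeriv_HzetaC (n : ℕ) {x : ℝ} (hx : 1 ≤ x) {z : ℂ} (hz : 1 < z.re) :
    iteratedDeriv n (fun z : ℂ => HzetaC z x) z = ∑' k, hurwitzTerm n x k z := by
  induction n generalizing z with
  | zero => simp [HzetaC, hurwitzTerm]
  | succ n ih =>
    obtain ⟨r, hr, hrz⟩ := exists_between hz
    have hopen : IsOpen {w : ℂ | r < w.re} := isOpen_lt continuous_const Complex.continuous_re
    have hev : iteratedDeriv n (fun z : ℂ => HzetaC z x) =ᶠ[nhds z]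
        fun w => ∑' k, hurwitzTerm n x k w := by
      filter_upwards [hopen.mem_nhds hrz] with w hw using ih (hr.trans hw)
    have hs := Complex.hasSum_deriv_of_summable_norm (F := hurwitzTerm n x)
      (summable_logPowRpow n hr x)
      (fun k w _ => (hasDerivAt_hurwitzTerm n hx k w).differentiableAt.differentiableWithinAt)
      hopen (fun k w hw => by
        rw [norm_hurwitzTerm n hx]
        have h1 : 1 ≤ (k : ℝ) + x := by linarith [Nat.cast_nonneg (α := ℝ) k]
        exact mul_le_mul_of_nonneg_left
          (Real.rpow_le_rpow_of_exponent_le h1 (neg_le_neg (le_of_lt hw)))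
          (pow_nonneg (Real.log_nonneg h1) n)) hrz
    rw [iteratedDeriv_succ, hev.deriv_eq, ← hs.tsum_eq]
    exact tsum_congr fun k => (hasDerivAt_hurwitzTerm n hx k z).deriv

theorem iteratedDeriv_HzetaC_ofReal (n : ℕ) {x : ℝ} (hx : 1 ≤ x) {y : ℝ} (hy : 1 < y) :
    iteratedDeriv n (fun z : ℂ => HzetaC z x) (y : ℂ) =
      (((-1) ^ n * ∑' k : ℕ, logPowRpow n y (k + x) : ℝ) : ℂ) := by
  rw [iteratedDeriv_HzetaC n hx (by simpa using hy), ← tsum_mul_left, Complex.ofReal_tsum]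
  refine tsum_congr fun k => ?_
  have hpos : 0 < (k : ℝ) + x := by positivity
  rw [hurwitzTerm, logPowRpow]
  push_cast [Complex.ofReal_cpow hpos.le]
  rw [neg_pow, mul_assoc]

/-- Minus an antiderivative of `logPowRpow j y` vanishing at infinity. -/
noncomputable def logPowRpowTail (j : ℕ) (y t : ℝ) : ℝ :=
  ∑ i ∈ range (j + 1), (j.descFactorial i : ℝ) / (y - 1) ^ (i + 1) * logPowRpow (j - i) (y - 1) t

theorem hasDerivAt_logPowRpowTail (j : ℕ) {y : ℝ} (hy : 1 < y) {t : ℝ} (ht : 0 < t) :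
    HasDerivAt (logPowRpowTail j y) (-logPowRpow j y t) t := by
  have hy' : y - 1 ≠ 0 := by linarith
  have h := HasDerivAt.fun_sum (u := range (j + 1)) fun i _ =>
    (hasDerivAt_logPowRpow (j - i) (y - 1) ht).const_mul
      ((j.descFactorial i : ℝ) / (y - 1) ^ (i + 1))
  refine h.congr_deriv ?_
  let a : ℕ → ℝ := fun i => (j.descFactorial i : ℝ) / (y - 1) ^ i * logPowRpow (j - i) y t
  have hterm : ∀ i ∈ range (j + 1), (j.descFactorial i : ℝ) / (y - 1) ^ (i + 1) *
      logPowRpowDeriv (j - i) (y - 1) t = a (i + 1) - a i := by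
    intro i _
    simp only [a, logPowRpowDeriv, sub_add_cancel, Nat.descFactorial_succ, Nat.sub_sub]
    push_cast
    field_simp
    ring
  rw [sum_congr rfl hterm, sum_range_sub]
  simp [a]

theorem tendsto_logPowRpowTail (j : ℕ) {y : ℝ} (hy : 1 < y) :
    Tendsto (logPowRpowTail j y) atTop (nhds 0) := by
  have h := tendsto_finsetSum (range (j + 1)) fun i _ =>
    (tendsto_logPowRpow (j - i) (sub_pos.2 hy)).const_mul
      ((j.descFactorial i : ℝ) / (y - 1) ^ (i + 1))
  simp only [mul_zero, sum_const_zero] at h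
  exact h

theorem abs_sub_tsum_le_of_telescope {H K f : ℝ → ℝ} {x : ℝ}
    (hf : Summable fun k : ℕ => f (k + x)) (hH : Tendsto H atTop (nhds 0))
    (hK : Tendsto K atTop (nhds 0))
    (hb : ∀ t, x ≤ t → |H t - H (t + 1) - f t| ≤ K t - K (t + 1)) :
    |∑' k : ℕ, f (k + x) - H x| ≤ K x := by
  have hfin : ∀ N : ℕ, |∑ k ∈ range N, f (k + x) - (H x - H (N + x))| ≤ K x - K (N + x) := by
    intro N
    induction N with
    | zero => simp
    | succ N ih =>
      have h := hb (N + x) (by linarith [Nat.cast_nonneg (α := ℝ) N])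
      rw [sum_range_succ]
      have e : ((N + 1 : ℕ) : ℝ) + x = N + x + 1 := by push_cast; ring
      rw [e]
      rw [abs_le] at *
      constructor <;> linarith [ih.1, ih.2, h.1, h.2]
  have hx := tendsto_natCast_add_atTop x
  have h1 := (hf.hasSum.tendsto_sum_nat.sub ((hH.comp hx).const_sub (H x))).abs
  have h2 := (hK.comp hx).const_sub (K x)
  simpa using le_of_tendsto_of_tendsto' h1 h2 hfin

theorem exists_abs_tsum_logPowRpow_sub_le (j : ℕ) {y : ℝ} (hy : 1 < y) :
    ∃ C : ℝ, ∀ x : ℝ, Real.exp 1 ≤ x → Real.exp j ≤ x →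
      |∑' k : ℕ, logPowRpow j y (k + x) - (logPowRpowTail j y x + logPowRpow j y x / 2)|
        ≤ C * logPowRpow j (y + 1) x := by
  set M : ℝ := (j + y) * (j + y + 1)
  have hM0 : 0 ≤ M := by positivity
  refine ⟨M * 2 ^ (y + 1 + 1), fun x hx hjx => ?_⟩
  refine abs_sub_tsum_le_of_telescope
    (H := fun t => logPowRpowTail j y t + logPowRpow j y t / 2)
    (K := fun t => M * 2 ^ (y + 1 + 1) * logPowRpow j (y + 1) t)
    (summable_logPowRpow j hy x) ?_ ?_ ?_
  · simpa using (tendsto_logPowRpowTail j hy).add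
      ((tendsto_logPowRpow j (show 0 < y by linarith)).div_const 2)
  · simpa using (tendsto_logPowRpow j (show 0 < y + 1 by linarith)).const_mul
      (M * 2 ^ (y + 1 + 1))
  · intro t ht
    have het : Real.exp 1 ≤ t := hx.trans ht
    have hpos : 0 < t := (Real.exp_pos 1).trans_le het
    have h1t : 1 ≤ t := (Real.one_le_exp zero_le_one).trans het
    have hbound := abs_trapezoid_error_le (F := fun u => -logPowRpowTail j y u)
      (f := logPowRpow j y) (f₁ := logPowRpowDeriv j y)
      (f₂ := fun u => j * logPowRpowDeriv (j - 1) (y + 1) u - y * logPowRpowDeriv j (y + 1) u)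
      (a := t) (M := M * logPowRpow j (y + 1 + 1) t)
      (mul_nonneg hM0 (logPowRpow_nonneg j _ h1t))
      (fun u hu => (hasDerivAt_logPowRpowTail j hy (hpos.trans_le hu)).fun_neg.congr_deriv
        (neg_neg _))
      (fun u hu => hasDerivAt_logPowRpow j y (hpos.trans_le hu))
      (fun u hu => ((hasDerivAt_logPowRpow (j - 1) (y + 1) (hpos.trans_le hu)).const_mul _).sub
        ((hasDerivAt_logPowRpow j (y + 1) (hpos.trans_le hu)).const_mul _))
      (fun u hu => by
        have heu := het.trans hu.1
        have hd1 := abs_logPowRpowDeriv_le (j - 1) (show 0 ≤ y + 1 by linarith) heu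
        have hd2 := abs_logPowRpowDeriv_le j (show 0 ≤ y + 1 by linarith) heu
        have hp := logPowRpow_pred_le j (y + 1 + 1) heu
        have hj : ((j - 1 : ℕ) : ℝ) ≤ j := by exact_mod_cast Nat.sub_le j 1
        have hg := logPowRpow_nonneg j (y + 1 + 1) (h1t.trans hu.1)
        have hanti := logPowRpow_antitone (n := j) (show 1 ≤ y + 1 + 1 by linarith) het
          (hjx.trans ht) hu.1
        have hd1' : |logPowRpowDeriv (j - 1) (y + 1) u| ≤
            (j + (y + 1)) * logPowRpow j (y + 1 + 1) u :=
          hd1.trans (mul_le_mul (by linarith) hp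
            (logPowRpow_nonneg _ _ (h1t.trans hu.1)) (by positivity))
        calc _ ≤ |j * logPowRpowDeriv (j - 1) (y + 1) u| + |y * logPowRpowDeriv j (y + 1) u| :=
              abs_sub _ _
          _ ≤ j * ((j + (y + 1)) * logPowRpow j (y + 1 + 1) u) +
              y * ((j + (y + 1)) * logPowRpow j (y + 1 + 1) u) := by
            rw [abs_mul, abs_mul, abs_of_nonneg (Nat.cast_nonneg (α := ℝ) j),
              abs_of_nonneg (show 0 ≤ y by linarith)]
            gcongr
          _ = (j + y) * (j + y + 1) * logPowRpow j (y + 1 + 1) u := by ring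
          _ ≤ M * logPowRpow j (y + 1 + 1) t := by
            exact mul_le_mul_of_nonneg_left hanti hM0)
    have hstep := mul_le_mul_of_nonneg_left
      (logPowRpow_le_mul_sub (n := j) (show 2 ≤ y + 1 by linarith) het (hjx.trans ht)) hM0
    calc _ = |(-logPowRpowTail j y (t + 1)) - (-logPowRpowTail j y t) -
              (logPowRpow j y t + logPowRpow j y (t + 1)) / 2| := by
            congr 1
            ring
      _ ≤ _ := hbound
      _ ≤ _ := hstep
      _ = _ := by ring

theorem hurwitz_deriv_asymptotic (j : ℕ) (y : ℝ) (hy : 1 < y) :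
    (fun x : ℝ => iteratedDeriv j (fun z : ℂ => HzetaC z x) (y : ℂ)
        - (((∑ t ∈ Finset.range (j + 1), (j.choose t : ℝ) * (-1 : ℝ) ^ j
              * (Nat.factorial t : ℝ) / (y - 1) ^ (t + 1)
              * (Real.log x) ^ (j - t) / x ^ (y - 1))
            + (-1 : ℝ) ^ j * (Real.log x) ^ j / (2 * x ^ y) : ℝ) : ℂ))
      =O[Filter.atTop] (fun x : ℝ => (Real.log x) ^ j / x ^ (y + 1)) := by
  obtain ⟨C, hC⟩ := exists_abs_tsum_logPowRpow_sub_le j hy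
  refine IsBigO.of_bound C ?_
  filter_upwards [eventually_ge_atTop (Real.exp 1), eventually_ge_atTop (Real.exp j)] with x h1 hj
  have hx1 : 1 ≤ x := (Real.one_le_exp zero_le_one).trans h1
  have hx0 : 0 < x := by linarith
  have hmain : (∑ t ∈ Finset.range (j + 1), (j.choose t : ℝ) * (-1 : ℝ) ^ j
              * (Nat.factorial t : ℝ) / (y - 1) ^ (t + 1)
              * (Real.log x) ^ (j - t) / x ^ (y - 1))
            + (-1 : ℝ) ^ j * (Real.log x) ^ j / (2 * x ^ y)
      = (-1) ^ j * (logPowRpowTail j y x + logPowRpow j y x / 2) := by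
    rw [mul_add, logPowRpowTail, mul_sum]
    congr 1
    · refine sum_congr rfl fun i _ => ?_
      rw [logPowRpow, Real.rpow_neg hx0.le, Nat.descFactorial_eq_factorial_mul_choose]
      push_cast
      ring
    · rw [logPowRpow, Real.rpow_neg hx0.le, mul_comm (2 : ℝ), ← div_div]
      ring
  have hK : Real.log x ^ j / x ^ (y + 1) = logPowRpow j (y + 1) x := by
    rw [logPowRpow, Real.rpow_neg hx0.le, div_eq_mul_inv]
  rw [hmain, iteratedDeriv_HzetaC_ofReal j hx1 hy, ← Complex.ofReal_sub, ← mul_sub,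
    Complex.norm_real, norm_mul, norm_pow, norm_neg, norm_one, one_pow, one_mul, hK,
    Real.norm_of_nonneg (logPowRpow_nonneg j (y + 1) hx1)]
  exact hC x h1 hj
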